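/- arXiv:1405.2502 — 2 statements merged into one kernel-verified Lean document; each statement's English description precedes it below -/
import Mathlib

section
/- For every bipartite density matrix ρ_AB, one has 0 ≤ μ(ρ_AB) ≤ 1, and μ(ρ_AB) = 0 if and only if ρ_AB is a product state, i.e., ρ_AB = ρ_A ⊗ ρ_B. -/
open scoped Matrix Kronecker ComplexOrder
open Matrix

noncomputable section

/-- Partial trace over the second (B) system. -/
def ptrB {A B : Type*} [Fintype B] (ρ : Matrix (A × B) (A × B) ℂ) : Matrix A A ℂ :=
  fun i j => ∑ k, ρ (i, k) (j, k)

/-- Partial trace over the first (A) system. -/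
def ptrA {A B : Type*} [Fintype A] (ρ : Matrix (A × B) (A × B) ℂ) : Matrix B B ℂ :=
  fun k l => ∑ i, ρ (i, k) (i, l)

/-- A density matrix: positive semidefinite with trace one. -/
def IsDensity {n : Type*} [Fintype n] (ρ : Matrix n n ℂ) : Prop :=
  ρ.PosSemidef ∧ ρ.trace = 1

/-- Maximal correlation of a bipartite state. -/
def mu {A B : Type*} [Fintype A] [Fintype B] (ρ : Matrix (A × B) (A × B) ℂ) : ℝ :=
  sSup {r : ℝ | ∃ (X : Matrix A A ℂ) (Y : Matrix B B ℂ),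
    ((ptrB ρ) * X).trace = 0 ∧ ((ptrA ρ) * Y).trace = 0 ∧
    ((ptrB ρ) * (X * Xᴴ)).trace = 1 ∧ ((ptrA ρ) * (Y * Yᴴ)).trace = 1 ∧
    r = ‖(ρ * (X ⊗ₖ Yᴴ)).trace‖}

/-- Maximal entanglement: infimum over finite decompositions of the max correlation. -/
def muEnt {A B : Type*} [Fintype A] [Fintype B] (ρ : Matrix (A × B) (A × B) ℂ) : ℝ :=
  sInf {r : ℝ | ∃ (m : ℕ) (p : Fin m → ℝ) (τ : Fin m → Matrix (A × B) (A × B) ℂ),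
    (∀ i, 0 ≤ p i) ∧ (∑ i, p i) = 1 ∧ (∀ i, IsDensity (τ i)) ∧
    ρ = ∑ i, p i • τ i ∧ r = ⨆ i, mu (τ i)}

/-- Application of a product channel given by local Kraus operators. -/
def applyLocal {A B A' B' ι κ : Type*} [Fintype A] [Fintype B] [Fintype ι] [Fintype κ]
    (K : ι → Matrix A' A ℂ) (L : κ → Matrix B' B ℂ)
    (ρ : Matrix (A × B) (A × B) ℂ) : Matrix (A' × B') (A' × B') ℂ :=
  ∑ k, ∑ m, (K k ⊗ₖ L m) * ρ * (K k ⊗ₖ L m)ᴴ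

/-- Tensor product of two bipartite states, with the A-systems grouped together. -/
def prodState {A B A' B' : Type*}
    (ρ : Matrix (A × B) (A × B) ℂ) (σ : Matrix (A' × B') (A' × B') ℂ) :
    Matrix ((A × A') × (B × B')) ((A × A') × (B × B')) ℂ :=
  fun x y => ρ (x.1.1, x.2.1) (y.1.1, y.2.1) * σ (x.1.2, x.2.2) (y.1.2, y.2.2)

/-- n-fold tensor power of a bipartite state, with all A-systems grouped together. -/
def powState {A B : Type*} (ρ : Matrix (A × B) (A × B) ℂ) (n : ℕ) :
    Matrix ((Fin n → A) × (Fin n → B)) ((Fin n → A) × (Fin n → B)) ℂ :=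
  fun x y => ∏ i, ρ (x.1 i, x.2 i) (y.1 i, y.2 i)

/-- The two-qubit Bell vector (|00⟩+|11⟩)/√2. -/
def bellVec : Fin 2 × Fin 2 → ℂ := fun p => if p.1 = p.2 then 1 / (Real.sqrt 2 : ℂ) else 0

/-- Inverse of the positive semidefinite square root. -/
def invSqrt {n : Type*} [Fintype n] [DecidableEq n] (M : Matrix n n ℂ) : Matrix n n ℂ :=
  letI := Classical.dec M.PosSemidef
  if h : M.PosSemidef then
    ((h.1.eigenvectorUnitary : Matrix n n ℂ) * diagonal ((↑) ∘ Real.sqrt ∘ h.1.eigenvalues) *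
      (star h.1.eigenvectorUnitary : Matrix n n ℂ))⁻¹ else 0


theorem Matrix.IsHermitian.ptrA {A B : Type*} [Fintype A] {ρ : Matrix (A × B) (A × B) ℂ}
    (hρ : ρ.IsHermitian) : (ptrA ρ).IsHermitian := by
  ext k l
  simp only [conjTranspose_apply, _root_.ptrA, star_sum]
  exact Finset.sum_congr rfl fun i _ => hρ.apply _ _

section Correlation

variable {A B n : Type*} [Fintype A] [Fintype B] [Fintype n]

/-- Cauchy–Schwarz for the semi-inner product `(M, N) ↦ tr (ρ M Nᴴ)`. -/
theorem norm_trace_mul_conjTranspose_sq_le {ρ : Matrix n n ℂ} (hρ : ρ.PosSemidef)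
    (M N : Matrix n n ℂ) :
    ‖(ρ * (M * Nᴴ)).trace‖ ^ 2 ≤ (ρ * (M * Mᴴ)).trace.re * (ρ * (N * Nᴴ)).trace.re := by
  let : SeminormedAddCommGroup (Matrix n n ℂ) := ρ.toMatrixSeminormedAddCommGroup hρ
  let : InnerProductSpace ℂ (Matrix n n ℂ) := ρ.toMatrixInnerProductSpace hρ
  have inner_eq (x y : Matrix n n ℂ) : inner ℂ xᴴ yᴴ = (ρ * (x * yᴴ)).trace := by
    change (yᴴ * ρ * xᴴᴴ).trace = _
    rw [conjTranspose_conjTranspose, Matrix.mul_assoc, trace_mul_comm, Matrix.mul_assoc]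
  have h := inner_mul_inner_self_le (𝕜 := ℂ) Mᴴ Nᴴ
  rw [norm_inner_symm Nᴴ Mᴴ, ← sq] at h
  simpa only [inner_eq, RCLike.re_eq_complex_re] using h

theorem trace_mul_mul_conjTranspose_self_nonneg {ρ : Matrix n n ℂ} (hρ : ρ.PosSemidef)
    (M : Matrix n n ℂ) : 0 ≤ (ρ * (M * Mᴴ)).trace := by
  rw [← Matrix.mul_assoc, trace_mul_comm, ← Matrix.mul_assoc]
  exact (hρ.conjTranspose_mul_mul_same M).trace_nonneg

theorem trace_ptrB_mul [DecidableEq B] (ρ : Matrix (A × B) (A × B) ℂ) (X : Matrix A A ℂ) :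
    (ptrB ρ * X).trace = (ρ * (X ⊗ₖ (1 : Matrix B B ℂ))).trace := by
  simp only [trace, diag, mul_apply, ptrB, kroneckerMap_apply, Fintype.sum_prod_type, one_apply,
    mul_ite, mul_one, mul_zero, Finset.sum_ite_eq', Finset.mem_univ, if_true, Finset.sum_mul]
  exact Finset.sum_congr rfl fun _ _ => Finset.sum_comm

theorem trace_ptrA_mul [DecidableEq A] (ρ : Matrix (A × B) (A × B) ℂ) (Y : Matrix B B ℂ) :
    (ptrA ρ * Y).trace = (ρ * ((1 : Matrix A A ℂ) ⊗ₖ Y)).trace := by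
  simp only [trace, diag, mul_apply, ptrA, kroneckerMap_apply, Fintype.sum_prod_type_right,
    one_apply, ite_mul, mul_ite, one_mul, zero_mul, mul_zero, Finset.sum_ite_eq', Finset.mem_univ,
    if_true, Finset.sum_mul]
  exact Finset.sum_congr rfl fun _ _ => Finset.sum_comm

theorem trace_ptrB (ρ : Matrix (A × B) (A × B) ℂ) : (ptrB ρ).trace = ρ.trace := by
  classical
  simpa using trace_ptrB_mul ρ 1

theorem trace_ptrA (ρ : Matrix (A × B) (A × B) ℂ) : (ptrA ρ).trace = ρ.trace := by
  classical
  simpa using trace_ptrA_mul ρ 1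

theorem trace_mul_conjTranspose_of_isHermitian {ρ : Matrix n n ℂ} (hρ : ρ.IsHermitian)
    (M : Matrix n n ℂ) : (ρ * Mᴴ).trace = star (ρ * M).trace := by
  rw [← trace_conjTranspose, conjTranspose_mul, hρ.eq, trace_mul_comm]

theorem trace_ptrB_mul_conjTranspose_self_nonneg {ρ : Matrix (A × B) (A × B) ℂ}
    (hρ : ρ.PosSemidef) (X : Matrix A A ℂ) : 0 ≤ (ptrB ρ * (X * Xᴴ)).trace := by
  classical
  have h := trace_mul_mul_conjTranspose_self_nonneg hρ (X ⊗ₖ (1 : Matrix B B ℂ))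
  rwa [conjTranspose_kronecker, ← mul_kronecker_mul, conjTranspose_one, one_mul,
    ← trace_ptrB_mul] at h

theorem trace_ptrA_mul_conjTranspose_self_nonneg {ρ : Matrix (A × B) (A × B) ℂ}
    (hρ : ρ.PosSemidef) (Y : Matrix B B ℂ) : 0 ≤ (ptrA ρ * (Y * Yᴴ)).trace := by
  classical
  have h := trace_mul_mul_conjTranspose_self_nonneg hρ ((1 : Matrix A A ℂ) ⊗ₖ Y)
  rwa [conjTranspose_kronecker, ← mul_kronecker_mul, conjTranspose_one, one_mul,
    ← trace_ptrA_mul] at h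

theorem norm_trace_mul_kronecker_sq_le {ρ : Matrix (A × B) (A × B) ℂ} (hρ : ρ.PosSemidef)
    (X : Matrix A A ℂ) (Y : Matrix B B ℂ) :
    ‖(ρ * (X ⊗ₖ Yᴴ)).trace‖ ^ 2 ≤
      (ptrB ρ * (X * Xᴴ)).trace.re * (ptrA ρ * (Y * Yᴴ)).trace.re := by
  classical
  have h := norm_trace_mul_conjTranspose_sq_le hρ (X ⊗ₖ (1 : Matrix B B ℂ))
    ((1 : Matrix A A ℂ) ⊗ₖ Y)
  simpa only [conjTranspose_kronecker, ← mul_kronecker_mul, conjTranspose_one, one_mul, mul_one,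
    ← trace_ptrB_mul, ← trace_ptrA_mul] using h

theorem norm_trace_mul_kronecker_le_one {ρ : Matrix (A × B) (A × B) ℂ} (hρ : ρ.PosSemidef)
    {X : Matrix A A ℂ} {Y : Matrix B B ℂ} (hX : (ptrB ρ * (X * Xᴴ)).trace = 1)
    (hY : (ptrA ρ * (Y * Yᴴ)).trace = 1) : ‖(ρ * (X ⊗ₖ Yᴴ)).trace‖ ≤ 1 := by
  have h := norm_trace_mul_kronecker_sq_le hρ X Y
  rw [hX, hY, Complex.one_re, one_mul] at h
  exact (sq_le_one_iff₀ (norm_nonneg _)).mp h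

theorem mu_nonneg (ρ : Matrix (A × B) (A × B) ℂ) : 0 ≤ mu ρ := by
  refine Real.sSup_nonneg ?_
  rintro _ ⟨X, Y, -, -, -, -, rfl⟩
  exact norm_nonneg _

theorem mu_le_one {ρ : Matrix (A × B) (A × B) ℂ} (hρ : ρ.PosSemidef) : mu ρ ≤ 1 := by
  refine Real.sSup_le ?_ zero_le_one
  rintro _ ⟨X, Y, -, -, hX, hY, rfl⟩
  exact norm_trace_mul_kronecker_le_one hρ hX hY

theorem norm_trace_mul_kronecker_le_mu {ρ : Matrix (A × B) (A × B) ℂ} (hρ : ρ.PosSemidef)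
    {X : Matrix A A ℂ} {Y : Matrix B B ℂ} (hX₀ : (ptrB ρ * X).trace = 0)
    (hY₀ : (ptrA ρ * Y).trace = 0) (hX : (ptrB ρ * (X * Xᴴ)).trace = 1)
    (hY : (ptrA ρ * (Y * Yᴴ)).trace = 1) : ‖(ρ * (X ⊗ₖ Yᴴ)).trace‖ ≤ mu ρ := by
  refine le_csSup ⟨1, ?_⟩ ⟨X, Y, hX₀, hY₀, hX, hY, rfl⟩
  rintro _ ⟨X, Y, -, -, hX, hY, rfl⟩
  exact norm_trace_mul_kronecker_le_one hρ hX hY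

theorem trace_mul_smul_mul_conjTranspose_eq_one {σ M : Matrix n n ℂ}
    (h : 0 < (σ * (M * Mᴴ)).trace) :
    (σ * ((((√(σ * (M * Mᴴ)).trace.re)⁻¹ : ℝ) : ℂ) • M *
      ((((√(σ * (M * Mᴴ)).trace.re)⁻¹ : ℝ) : ℂ) • M)ᴴ)).trace = 1 := by
  obtain ⟨hre, him⟩ := Complex.pos_iff.mp h
  set t := (σ * (M * Mᴴ)).trace with ht
  have htre : t = (t.re : ℂ) := Complex.ext rfl (by simpa using him.symm)
  simp only [conjTranspose_smul, smul_mul_assoc, mul_smul_comm, trace_smul, smul_eq_mul,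
    Complex.star_def, Complex.conj_ofReal, ← ht]
  rw [htre, Complex.ofReal_re]
  norm_cast
  rw [← mul_assoc, ← mul_inv, Real.mul_self_sqrt hre.le, inv_mul_cancel₀ hre.ne']

theorem trace_mul_kronecker_eq_zero_of_mu_eq_zero {ρ : Matrix (A × B) (A × B) ℂ}
    (hρ : ρ.PosSemidef) (hμ : mu ρ = 0) {X : Matrix A A ℂ} {Y : Matrix B B ℂ}
    (hX₀ : (ptrB ρ * X).trace = 0) (hY₀ : (ptrA ρ * Y).trace = 0) :
    (ρ * (X ⊗ₖ Yᴴ)).trace = 0 := by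
  have hCS := norm_trace_mul_kronecker_sq_le hρ X Y
  rcases (trace_ptrB_mul_conjTranspose_self_nonneg hρ X).eq_or_lt with hX | hX
  · simpa [← hX] using hCS
  rcases (trace_ptrA_mul_conjTranspose_self_nonneg hρ Y).eq_or_lt with hY | hY
  · simpa [← hY] using hCS
  have h := norm_trace_mul_kronecker_le_mu hρ
    (by rw [mul_smul_comm, trace_smul, hX₀, smul_zero])
    (by rw [mul_smul_comm, trace_smul, hY₀, smul_zero])
    (trace_mul_smul_mul_conjTranspose_eq_one hX) (trace_mul_smul_mul_conjTranspose_eq_one hY)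
  rw [hμ, norm_le_zero_iff, conjTranspose_smul, smul_kronecker, kronecker_smul, mul_smul_comm,
    mul_smul_comm, trace_smul, trace_smul, smul_eq_mul, smul_eq_mul] at h
  have hsX := (Real.sqrt_pos.mpr (Complex.pos_iff.mp hX).1).ne'
  have hsY := (Real.sqrt_pos.mpr (Complex.pos_iff.mp hY).1).ne'
  simpa [hsX, hsY] using h

theorem mu_eq_zero_of_eq_kronecker {ρ : Matrix (A × B) (A × B) ℂ}
    (h : ρ = ptrB ρ ⊗ₖ ptrA ρ) : mu ρ = 0 := by
  refine le_antisymm (Real.sSup_le ?_ le_rfl) (mu_nonneg ρ)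
  rintro _ ⟨X, Y, hX, -, -, -, rfl⟩
  have hprod : (ρ * (X ⊗ₖ Yᴴ)).trace = (ptrB ρ * X).trace * (ptrA ρ * Yᴴ).trace := by
    conv_lhs => rw [h]
    rw [← mul_kronecker_mul, trace_kronecker]
  rw [hprod, hX, zero_mul, norm_zero]

theorem eq_of_trace_mul_kronecker_eq {ρ σ : Matrix (A × B) (A × B) ℂ}
    (h : ∀ (X : Matrix A A ℂ) (Z : Matrix B B ℂ),
      (ρ * (X ⊗ₖ Z)).trace = (σ * (X ⊗ₖ Z)).trace) : ρ = σ := by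
  classical
  ext ⟨i, k⟩ ⟨j, l⟩
  have := h (single j i 1) (single l k 1)
  simpa [single_kronecker_single, trace_mul_single] using this

theorem eq_kronecker_of_mu_eq_zero {ρ : Matrix (A × B) (A × B) ℂ} (hρ : IsDensity ρ)
    (hμ : mu ρ = 0) : ρ = ptrB ρ ⊗ₖ ptrA ρ := by
  classical
  obtain ⟨hpos, htr⟩ := hρ
  refine eq_of_trace_mul_kronecker_eq fun X Z => ?_
  rw [← mul_kronecker_mul, trace_kronecker]
  set a := (ptrB ρ * X).trace with ha
  set b := (ptrA ρ * Z).trace with hb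
  have hX : (ptrB ρ * (X - a • (1 : Matrix A A ℂ))).trace = 0 := by
    simp [Matrix.mul_sub, trace_ptrB, htr, ← ha]
  have hZ : (ptrA ρ * (Z - b • (1 : Matrix B B ℂ))ᴴ).trace = 0 := by
    rw [trace_mul_conjTranspose_of_isHermitian hpos.isHermitian.ptrA]
    simp [Matrix.mul_sub, trace_ptrA, htr, ← hb]
  have h := trace_mul_kronecker_eq_zero_of_mu_eq_zero hpos hμ hX hZ
  rw [conjTranspose_conjTranspose, sub_eq_add_neg, sub_eq_add_neg, ← neg_smul, ← neg_smul,
    add_kronecker, kronecker_add, kronecker_add] at h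
  simp only [smul_kronecker, kronecker_smul, Matrix.mul_add, mul_smul_comm, trace_add, trace_smul,
    ← trace_ptrB_mul, ← trace_ptrA_mul, mul_one, trace_ptrB, htr, smul_eq_mul, ← ha, ← hb] at h
  linear_combination h

end Correlation

/-- `0 ≤ μ(ρ) ≤ 1`, and `μ(ρ) = 0` iff `ρ` is a product state. -/
theorem mu_bounds_and_zero_iff_product {dA dB : ℕ}
    (ρ : Matrix (Fin dA × Fin dB) (Fin dA × Fin dB) ℂ) (hρ : IsDensity ρ) :
    0 ≤ mu ρ ∧ mu ρ ≤ 1 ∧ (mu ρ = 0 ↔ ρ = ptrB ρ ⊗ₖ ptrA ρ) :=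
  ⟨mu_nonneg ρ, mu_le_one hρ.1, eq_kronecker_of_mu_eq_zero hρ, mu_eq_zero_of_eq_kronecker⟩
end
end

section
/- Let ρ_AB = |ψ⟩⟨ψ| be a pure bipartite state, where ψ is a unit vector in ℂ^{d_A} ⊗ ℂ^{d_B}. Then μ(ρ_AB) = 0 if ψ is a product vector (ψ = a ⊗ b for some vectors a ∈ ℂ^{d_A}, b ∈ ℂ^{d_B}), and μ(ρ_AB) = 1 if ψ is entangled (not a product vector). -/
open scoped Matrix Kronecker ComplexOrder
open Matrix

noncomputable section

section PureState

variable {A B : Type*}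

/-- The unnormalised pure state whose vector has the coefficient matrix `M`. -/
def pureState (M : Matrix A B ℂ) : Matrix (A × B) (A × B) ℂ :=
  vecMulVec (vec Mᵀ) (star (vec Mᵀ))

lemma ptrB_pureState [Fintype B] (M : Matrix A B ℂ) : ptrB (pureState M) = M * Mᴴ := rfl

lemma ptrA_pureState [Fintype A] (M : Matrix A B ℂ) : ptrA (pureState M) = (Mᴴ * M)ᵀ := by
  ext k l
  exact Finset.sum_congr rfl fun i _ => mul_comm _ _

variable [Fintype A] [Fintype B]

lemma trace_pureState_mul_kronecker (M : Matrix A B ℂ) (X : Matrix A A ℂ) (Y : Matrix B B ℂ) :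
    (pureState M * (X ⊗ₖ Yᴴ)).trace = ((Xᴴ * M)ᴴ * (M * Yᴴᵀ)).trace := by
  rw [pureState, trace_mul_comm, mul_vecMulVec, trace_vecMulVec, kronecker_mulVec_vec,
    dotProduct_comm, star_vec_dotProduct_vec, trace_mul_comm Mᵀᴴ, ← trace_transpose,
    conjTranspose_mul, conjTranspose_conjTranspose, transpose_mul, transpose_mul, transpose_mul,
    transpose_transpose, transpose_transpose, Matrix.mul_assoc]
  rfl

lemma trace_ptrB_pureState_mul_self_conjTranspose (M : Matrix A B ℂ) (X : Matrix A A ℂ) :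
    (ptrB (pureState M) * (X * Xᴴ)).trace = ((Xᴴ * M)ᴴ * (Xᴴ * M)).trace := by
  rw [ptrB_pureState, Matrix.mul_assoc, trace_mul_comm M]
  simp [conjTranspose_mul, Matrix.mul_assoc]

lemma trace_ptrA_pureState_mul_self_conjTranspose (M : Matrix A B ℂ) (Y : Matrix B B ℂ) :
    (ptrA (pureState M) * (Y * Yᴴ)).trace = ((M * Yᴴᵀ)ᴴ * (M * Yᴴᵀ)).trace := by
  have hY : Yᴴᵀᴴ = Yᵀ := by ext; simp
  rw [ptrA_pureState, ← trace_transpose, transpose_mul, transpose_mul, transpose_transpose,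
    conjTranspose_mul, hY, Matrix.mul_assoc, trace_mul_comm Yᴴᵀ]
  simp only [Matrix.mul_assoc]

/-- Cauchy-Schwarz for the Frobenius inner product. -/
lemma norm_trace_conjTranspose_mul_le_one {S T : Matrix A B ℂ}
    (hS : (Sᴴ * S).trace = 1) (hT : (Tᴴ * T).trace = 1) : ‖(Sᴴ * T).trace‖ ≤ 1 := by
  have inner_eq (U V : Matrix A B ℂ) :
      inner ℂ (WithLp.toLp 2 (vec U)) (WithLp.toLp 2 (vec V)) = (Uᴴ * V).trace := by
    rw [EuclideanSpace.inner_toLp_toLp, dotProduct_comm, star_vec_dotProduct_vec]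
  have norm_eq {U : Matrix A B ℂ} (hU : (Uᴴ * U).trace = 1) :
      ‖WithLp.toLp 2 (vec U)‖ = 1 := by
    rw [@norm_eq_sqrt_re_inner ℂ, inner_eq, hU]
    simp
  simpa [inner_eq, norm_eq hS, norm_eq hT] using
    norm_inner_le_norm (𝕜 := ℂ) (WithLp.toLp 2 (vec S)) (WithLp.toLp 2 (vec T))

lemma mu_pureState_vecMulVec (a : A → ℂ) (b : B → ℂ) :
    mu (pureState (vecMulVec a b)) = 0 := by
  refine le_antisymm (Real.sSup_nonpos ?_) (Real.sSup_nonneg ?_)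
  · rintro r ⟨X, Y, hX, -, hX1, -, rfl⟩
    have hX' : (b ⬝ᵥ star b) * (star a ⬝ᵥ X *ᵥ a) = 0 := by
      rw [← hX, ptrB_pureState, trace_mul_comm, conjTranspose_vecMulVec,
        vecMulVec_mul_vecMulVec, mul_vecMulVec, trace_vecMulVec, dotProduct_smul,
        dotProduct_comm (X *ᵥ a), smul_eq_mul]
    have hb : b ⬝ᵥ star b ≠ 0 := by
      intro h
      rw [ptrB_pureState, conjTranspose_vecMulVec, vecMulVec_mul_vecMulVec, h] at hX1
      simp at hX1
    have hXa := (mul_eq_zero.1 hX').resolve_left hb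
    rw [trace_pureState_mul_kronecker, conjTranspose_mul, conjTranspose_conjTranspose,
      conjTranspose_vecMulVec, vecMulVec_mul, vecMulVec_mul, vecMulVec_mul,
      vecMul_vecMulVec, ← dotProduct_mulVec, hXa]
    simp
  · rintro r ⟨X, Y, -, -, -, -, rfl⟩
    exact norm_nonneg _

/-- A matrix that is not an outer product admits a nonzero matrix of the form `M * N * M`
that is orthogonal to it. -/
lemma exists_mul_mul_ne_zero_of_not_vecMulVec [DecidableEq A] [DecidableEq B] {M : Matrix A B ℂ}
    (hM : ¬ ∃ a b, M = vecMulVec a b) :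
    ∃ N : Matrix B A ℂ, (Mᴴ * (M * N * M)).trace = 0 ∧ M * N * M ≠ 0 := by
  by_contra! h
  obtain ⟨j, l, hjl⟩ : ∃ j l, M j l ≠ 0 := by
    by_contra! h0
    exact hM ⟨0, 0, by ext; simp [h0]⟩
  let f (k : B) : ℂ := (Mᴴ * (M * Matrix.single k j (1 : ℂ) * M)).trace
  have apply_eq (k k' : B) (i : A) : (M * Matrix.single k j (1 : ℂ) * M) i k' = M i k * M j k' := by
    simp [Matrix.mul_apply, Matrix.single_apply, ite_and]
  have key (k : B) (i : A) : f l * M i k = f k * M i l := by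
    have h0 := h (f l • Matrix.single k j (1 : ℂ) - f k • Matrix.single l j (1 : ℂ)) (by
      simp only [Matrix.mul_sub, Matrix.sub_mul, Matrix.mul_smul, Matrix.smul_mul, trace_sub,
        trace_smul, smul_eq_mul]
      exact sub_eq_zero.2 (mul_comm _ _))
    have h1 := congrFun₂ h0 i l
    simp only [Matrix.mul_sub, Matrix.sub_mul, Matrix.mul_smul, Matrix.smul_mul,
      Matrix.sub_apply, Matrix.smul_apply, apply_eq, smul_eq_mul, Matrix.zero_apply] at h1
    exact mul_right_cancel₀ hjl (by linear_combination h1)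
  have hf : f l ≠ 0 := by
    intro hl
    have h1 := congrFun₂ (h _ hl) j l
    rw [apply_eq] at h1
    simp [hjl] at h1
  refine hM ⟨fun i => M i l, fun k => f k / f l, ?_⟩
  ext i k
  rw [vecMulVec_apply, mul_div_assoc', eq_div_iff hf]
  linear_combination key k i

/-- Rescaling a nonzero matrix to unit Frobenius norm. -/
lemma exists_smul_trace_conjTranspose_mul_eq_one {T : Matrix A B ℂ} (hT : T ≠ 0) :
    ∃ c : ℂ, ((c • T)ᴴ * (c • T)).trace = 1 := by
  have hpos : 0 < (Tᴴ * T).trace :=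
    (posSemidef_conjTranspose_mul_self T).trace_nonneg.lt_of_ne'
      (mt trace_conjTranspose_mul_self_eq_zero_iff.1 hT)
  obtain ⟨t, ht, hteq⟩ := RCLike.pos_iff_exists_ofReal.1 hpos
  refine ⟨((√t)⁻¹ : ℝ), ?_⟩
  rw [conjTranspose_smul, Matrix.smul_mul, Matrix.mul_smul, trace_smul, trace_smul, ← hteq]
  simp only [smul_eq_mul, RCLike.star_def, Complex.conj_ofReal, Complex.coe_algebraMap]
  rw [← mul_assoc]
  norm_cast
  rw [← mul_inv, Real.mul_self_sqrt ht.le, inv_mul_cancel₀ ht.ne']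

lemma mu_pureState_of_not_vecMulVec [DecidableEq A] [DecidableEq B] {M : Matrix A B ℂ}
    (hM : ¬ ∃ a b, M = vecMulVec a b) : mu (pureState M) = 1 := by
  refine IsGreatest.csSup_eq ⟨?_, ?_⟩
  · obtain ⟨N', horth, hne⟩ := exists_mul_mul_ne_zero_of_not_vecMulVec hM
    obtain ⟨c, hc⟩ := exists_smul_trace_conjTranspose_mul_eq_one hne
    obtain ⟨N, hN⟩ : ∃ N, c • (M * N' * M) = M * N * M := ⟨c • N', by simp⟩
    rw [hN] at hc
    replace horth : (Mᴴ * (M * N * M)).trace = 0 := by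
      rw [← hN, Matrix.mul_smul, trace_smul, horth, smul_zero]
    have horth' : ((Mᴴ * (M * N * M))ᴴ).trace = 0 := by
      rw [trace_conjTranspose, horth, star_zero]
    have hW : M * (N * M)ᴴᵀᴴᵀ = M * N * M := by
      rw [Matrix.mul_assoc]
      congr 1
      ext
      simp only [transpose_apply, conjTranspose_apply, star_star]
    refine ⟨(M * N)ᴴ, (N * M)ᴴᵀ, ?_, ?_, ?_, ?_, ?_⟩
    · rw [ptrB_pureState, Matrix.mul_assoc, trace_mul_comm, ← horth', conjTranspose_mul Mᴴ,
        conjTranspose_mul (M * N), conjTranspose_conjTranspose]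
    · rw [ptrA_pureState, ← transpose_mul, trace_transpose, ← horth', Matrix.mul_assoc M,
        ← Matrix.mul_assoc Mᴴ, conjTranspose_mul (Mᴴ * M), conjTranspose_mul Mᴴ,
        conjTranspose_conjTranspose]
    · rw [trace_ptrB_pureState_mul_self_conjTranspose, conjTranspose_conjTranspose, hc]
    · rw [trace_ptrA_pureState_mul_self_conjTranspose, hW, hc]
    · rw [trace_pureState_mul_kronecker, conjTranspose_conjTranspose, hW, hc, norm_one]
  · rintro r ⟨X, Y, -, -, hX, hY, rfl⟩
    rw [trace_ptrB_pureState_mul_self_conjTranspose] at hX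
    rw [trace_ptrA_pureState_mul_self_conjTranspose] at hY
    rw [trace_pureState_mul_kronecker]
    exact norm_trace_conjTranspose_mul_le_one hX hY

end PureState

/-- For a pure state, `μ = 0` if the vector is a product vector and `μ = 1` otherwise. -/
theorem mu_pure_state {dA dB : ℕ} (ψ : Fin dA × Fin dB → ℂ)
    (hψ : ∑ x, Complex.normSq (ψ x) = 1) :
    ((∃ (a : Fin dA → ℂ) (b : Fin dB → ℂ), ψ = fun p => a p.1 * b p.2) →
        mu (Matrix.vecMulVec ψ (star ψ)) = 0) ∧
    ((¬ ∃ (a : Fin dA → ℂ) (b : Fin dB → ℂ), ψ = fun p => a p.1 * b p.2) →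
        mu (Matrix.vecMulVec ψ (star ψ)) = 1) := by
  have hstate : pureState (Matrix.of fun i k => ψ (i, k)) = vecMulVec ψ (star ψ) := rfl
  have hprod (a : Fin dA → ℂ) (b : Fin dB → ℂ) :
      (ψ = fun p => a p.1 * b p.2) ↔ (Matrix.of fun i k => ψ (i, k)) = vecMulVec a b := by
    simp [funext_iff, ← Matrix.ext_iff, vecMulVec_apply]
  simp only [hprod, ← hstate]
  refine ⟨?_, mu_pureState_of_not_vecMulVec⟩
  rintro ⟨a, b, h⟩
  rw [h, mu_pureState_vecMulVec]
end
end
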